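/- Let G be a nontrivial connected graph with Kemeny's constant κ defined via κ(H) = dᵀSd/(4mτ) (degree vector d, 2-forest matrix S, m edges, τ spanning trees of H). For any vertex v, let G̃_v be G with two pendant vertices a,b attached at v, and Ĝ_v be G̃_v with the additional edge ab. Then κ(Ĝ_v) > κ(G̃_v). -/

import Mathlib

open Matrix SimpleGraph

/-- `T` is a spanning tree of `G`: a subgraph (on the same vertex set) that is
connected and acyclic. -/
def IsSpanningTree {V : Type*} (G T : SimpleGraph V) : Prop :=
  T ≤ G ∧ T.Connected ∧ T.IsAcyclic

/-- The number of spanning trees of `G`. -/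
noncomputable def spanningTreeCount {V : Type*} (G : SimpleGraph V) : ℕ :=
  Nat.card {T : SimpleGraph V // IsSpanningTree G T}

/-- `F` is a spanning 2-forest of `G` separating `i` and `j`: an acyclic subgraph
with exactly two components, one containing `i` and the other containing `j`. -/
def IsTwoForestSep {V : Type*} (G F : SimpleGraph V) (i j : V) : Prop :=
  F ≤ G ∧ F.IsAcyclic ∧ ¬ F.Reachable i j ∧ ∀ x, F.Reachable x i ∨ F.Reachable x j

/-- The `(i,j)` entry of the 2-forest matrix of `G`. -/
noncomputable def twoForestCount {V : Type*} (G : SimpleGraph V) (i j : V) : ℕ :=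
  Nat.card {F : SimpleGraph V // IsTwoForestSep G F i j}

/-- The graph `G̃_v`: `G` with two new pendant vertices attached at `v`. -/
def tildeG {V : Type*} (G : SimpleGraph V) (v : V) : SimpleGraph (V ⊕ Fin 2) :=
  SimpleGraph.fromRel (fun x y =>
    (∃ a b, x = Sum.inl a ∧ y = Sum.inl b ∧ G.Adj a b) ∨
    (x = Sum.inl v ∧ ∃ c, y = Sum.inr c))

/-- The graph `Ĝ_v`: `G` with two new vertices `a, b` adjacent to `v` and to
each other. -/
def hatG {V : Type*} (G : SimpleGraph V) (v : V) : SimpleGraph (V ⊕ Fin 2) :=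
  SimpleGraph.fromRel (fun x y =>
    (∃ a b, x = Sum.inl a ∧ y = Sum.inl b ∧ G.Adj a b) ∨
    (x = Sum.inl v ∧ ∃ c, y = Sum.inr c) ∨
    (x = Sum.inr 0 ∧ y = Sum.inr 1))

/-- The degree vector of `H`, as a real vector. -/
noncomputable def degVec {W : Type*} (H : SimpleGraph W) : W → ℝ :=
  fun i => ((H.neighborSet i).ncard : ℝ)

/-- The number of edges of `H`, as a real number. -/
noncomputable def edgeCount {W : Type*} (H : SimpleGraph W) : ℝ :=
  (H.edgeSet.ncard : ℝ)

/-- The 2-forest matrix of `H`, as a real matrix. -/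
noncomputable def forestMatrix {W : Type*} (H : SimpleGraph W) : Matrix W W ℝ :=
  Matrix.of fun i j => ((twoForestCount H i j : ℝ))

/-- The Kemeny constant of `H`, via the formula `κ = dᵀSd / (4mτ)`. -/
noncomputable def kemeny {W : Type*} [Fintype W] (H : SimpleGraph W) : ℝ :=
  (degVec H ⬝ᵥ (forestMatrix H).mulVec (degVec H)) /
    (4 * edgeCount H * (spanningTreeCount H : ℝ))

/-- The graph on `V ⊕ Fin 2` whose restriction to `V` is `F` and whose further edges form a
subgraph of the triangle on `v` and the two new vertices, with `p`, `q`, `r` recording the presence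
of the edge from `v` to the first new vertex, from `v` to the second one, and between the two. -/
def triangleGlue {V : Type*} (v : V) (F : SimpleGraph V) (p q r : Bool) :
    SimpleGraph (V ⊕ Fin 2) where
  Adj
    | Sum.inl x, Sum.inl y => F.Adj x y
    | Sum.inl x, Sum.inr c => x = v ∧ (if c = 0 then p else q) = true
    | Sum.inr c, Sum.inl x => x = v ∧ (if c = 0 then p else q) = true
    | Sum.inr c, Sum.inr d => c ≠ d ∧ r = true
  symm := ⟨by rintro (x | c) (y | d) h; exacts [h.symm, h, h, ⟨h.1.symm, h.2⟩]⟩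
  loopless := ⟨by rintro (x | c) h <;> simp_all⟩

/-- The reachability relation of `triangleGlue v F p q r`, in terms of that of `F`. -/
def triangleGlueRel {V : Type*} (v : V) (F : SimpleGraph V) (p q r : Bool) :
    V ⊕ Fin 2 → V ⊕ Fin 2 → Prop
  | Sum.inl x, Sum.inl y => F.Reachable x y
  | Sum.inl x, Sum.inr c =>
    F.Reachable x v ∧ (if c = 0 then p || (q && r) else q || (p && r)) = true
  | Sum.inr c, Sum.inl x =>
    F.Reachable x v ∧ (if c = 0 then p || (q && r) else q || (p && r)) = true
  | Sum.inr c, Sum.inr d => c = d ∨ (r || (p && q)) = true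

lemma isAcyclic_iff_forall_adj_not_reachable {V : Type*} {G : SimpleGraph V} :
    G.IsAcyclic ↔ ∀ x y, G.Adj x y → ¬ (G.deleteEdges {s(x, y)}).Reachable x y := by
  rw [isAcyclic_iff_forall_isBridge, Sym2.forall]
  rfl

section TriangleGlue

variable {V : Type*} (v : V) (F : SimpleGraph V) (p q r : Bool)

lemma reachable_triangleGlue_iff (x y : V ⊕ Fin 2) :
    (triangleGlue v F p q r).Reachable x y ↔ triangleGlueRel v F p q r x y := by
  constructor
  · rw [reachable_iff_reflTransGen]
    intro h
    induction h with
    | refl => rcases x with x | c <;> simp [triangleGlueRel]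
    | @tail y z _ hyz ih =>
      rcases x with x | c <;> rcases y with y | d <;> rcases z with z | e <;>
        simp only [triangleGlueRel, triangleGlue] at hyz ih ⊢
      · exact ih.trans hyz.reachable
      · grind
      · grind [Reachable.symm]
      · fin_cases d <;> fin_cases e <;> simp_all
        all_goals grind
      · exact ⟨hyz.symm.reachable.trans ih.1, ih.2⟩
      · fin_cases c <;> fin_cases e <;> simp_all
        all_goals grind
      · fin_cases c <;> fin_cases d <;> simp_all
        all_goals grind [Reachable.rfl]
      · fin_cases c <;> fin_cases d <;> fin_cases e <;> simp_all
  · have hinl : ∀ {x y : V}, F.Reachable x y →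
        (triangleGlue v F p q r).Reachable (Sum.inl x) (Sum.inl y) := fun {x y} h =>
      h.map (G' := triangleGlue v F p q r) ⟨Sum.inl, fun h => h⟩
    have hp : p = true → (triangleGlue v F p q r).Reachable (Sum.inl v) (Sum.inr 0) :=
      fun h => Adj.reachable ⟨rfl, by simpa using h⟩
    have hq : q = true → (triangleGlue v F p q r).Reachable (Sum.inl v) (Sum.inr 1) :=
      fun h => Adj.reachable ⟨rfl, by simpa using h⟩
    have hr : r = true → (triangleGlue v F p q r).Reachable (Sum.inr 0) (Sum.inr 1) :=
      fun h => Adj.reachable ⟨by simp, h⟩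
    have hnew : ∀ c : Fin 2, (if c = 0 then p || (q && r) else q || (p && r)) = true →
        (triangleGlue v F p q r).Reachable (Sum.inl v) (Sum.inr c) := by
      intro c hc
      fin_cases c <;> simp at hc <;> rcases hc with hc | ⟨hc, hc'⟩
      exacts [hp hc, (hq hc).trans (hr hc').symm, hq hc, (hp hc).trans (hr hc')]
    intro h
    rcases x with x | c <;> rcases y with y | d <;> simp only [triangleGlueRel] at h
    · exact hinl h
    · exact (hinl h.1).trans (hnew d h.2)
    · exact ((hinl h.1).trans (hnew c h.2)).symm
    · have h01 : (r || (p && q)) = true →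
          (triangleGlue v F p q r).Reachable (Sum.inr 0) (Sum.inr 1) := by
        simp only [Bool.or_eq_true, Bool.and_eq_true]
        rintro (h | ⟨h, h'⟩)
        exacts [hr h, (hp h).symm.trans (hq h')]
      rcases h with rfl | h
      · rfl
      · fin_cases c <;> fin_cases d
        exacts [.rfl, h01 h, (h01 h).symm, .rfl]

lemma isAcyclic_triangleGlue_iff :
    (triangleGlue v F p q r).IsAcyclic ↔ F.IsAcyclic ∧ (p && q && r) = false := by
  have hV : ∀ x y, (triangleGlue v F p q r).deleteEdges {s(Sum.inl x, Sum.inl y)} =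
      triangleGlue v (F.deleteEdges {s(x, y)}) p q r := by
    intro x y
    ext (a | c) (b | d) <;> simp [triangleGlue]
  have hp : (triangleGlue v F p q r).deleteEdges {s(Sum.inl v, Sum.inr 0)} =
      triangleGlue v F false q r := by
    ext (a | c) (b | d) <;> simp [triangleGlue] <;> grind
  have hq : (triangleGlue v F p q r).deleteEdges {s(Sum.inl v, Sum.inr 1)} =
      triangleGlue v F p false r := by
    ext (a | c) (b | d) <;> simp [triangleGlue] <;> grind
  have hr : (triangleGlue v F p q r).deleteEdges {s(Sum.inr 0, Sum.inr 1)} =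
      triangleGlue v F p q false := by
    ext (a | c) (b | d) <;> simp [triangleGlue]
    grind
  rw [isAcyclic_iff_forall_adj_not_reachable, isAcyclic_iff_forall_adj_not_reachable]
  constructor
  · intro h
    refine ⟨fun x y hxy hr => h (Sum.inl x) (Sum.inl y) hxy ?_, ?_⟩
    · rwa [hV, reachable_triangleGlue_iff]
    · by_contra hpqr
      refine h (Sum.inl v) (Sum.inr 0) ⟨rfl, by simp_all⟩ ?_
      rw [hp, reachable_triangleGlue_iff]
      exact ⟨.rfl, by simp_all⟩
  · rintro ⟨hF, hpqr⟩ (x | c) (y | d) h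
    · rw [hV, reachable_triangleGlue_iff]
      exact hF x y h
    · obtain ⟨rfl, h⟩ := h
      fin_cases d <;> simp only [Fin.zero_eta, Fin.mk_one, hp, hq, reachable_triangleGlue_iff] <;>
        simp_all [triangleGlueRel]
    · obtain ⟨rfl, h⟩ := h
      rw [reachable_comm, Sym2.eq_swap]
      fin_cases c <;> simp only [Fin.zero_eta, Fin.mk_one, hp, hq, reachable_triangleGlue_iff] <;>
        simp_all [triangleGlueRel]
    · obtain ⟨hcd, h⟩ := h
      fin_cases c <;> fin_cases d <;> simp only [Fin.zero_eta, Fin.mk_one] at hcd ⊢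
      · exact absurd rfl hcd
      · rw [hr, reachable_triangleGlue_iff]
        simp_all [triangleGlueRel]
      · rw [Sym2.eq_swap, hr, reachable_triangleGlue_iff]
        simp_all [triangleGlueRel]
      · exact absurd rfl hcd

lemma triangleGlue_le_iff (F' : SimpleGraph V) (p' q' r' : Bool) :
    triangleGlue v F p q r ≤ triangleGlue v F' p' q' r' ↔ F ≤ F' ∧
      (p = true → p' = true) ∧ (q = true → q' = true) ∧ (r = true → r' = true) := by
  constructor
  · intro h
    refine ⟨fun x y hxy => h (v := Sum.inl x) (w := Sum.inl y) hxy, ?_, ?_, ?_⟩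
    · have := @h (Sum.inl v) (Sum.inr 0)
      simpa [triangleGlue] using this
    · have := @h (Sum.inl v) (Sum.inr 1)
      simpa [triangleGlue] using this
    · have := @h (Sum.inr 0) (Sum.inr 1)
      simpa [triangleGlue] using this
  · rintro ⟨hF, hp, hq, hr⟩ (x | c) (y | d) h <;> simp only [triangleGlue] at h ⊢
    · exact hF h
    all_goals grind

end TriangleGlue

lemma hatG_eq_triangleGlue {V : Type*} (G : SimpleGraph V) (v : V) :
    hatG G v = triangleGlue v G true true true := by
  ext (a | c) (b | d) <;> simp [hatG, triangleGlue, G.adj_comm]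
  · exact fun h => h.ne
  all_goals omega

lemma tildeG_eq_triangleGlue {V : Type*} (G : SimpleGraph V) (v : V) :
    tildeG G v = triangleGlue v G true true false := by
  ext (a | c) (b | d) <;> simp [tildeG, triangleGlue, G.adj_comm]
  · exact fun h => h.ne
  all_goals omega

lemma triangleGlue_injective {V : Type*} (v : V) :
    Function.Injective fun t : Bool × Bool × Bool × SimpleGraph V =>
      triangleGlue v t.2.2.2 t.1 t.2.1 t.2.2.1 := by
  rintro ⟨p, q, r, F⟩ ⟨p', q', r', F'⟩ h
  have h1 := (triangleGlue_le_iff ..).1 (le_of_eq h)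
  have h2 := (triangleGlue_le_iff ..).1 (ge_of_eq h)
  ext1
  · exact Bool.eq_iff_iff.2 ⟨h1.2.1, h2.2.1⟩
  ext1
  · exact Bool.eq_iff_iff.2 ⟨h1.2.2.1, h2.2.2.1⟩
  ext1
  · exact Bool.eq_iff_iff.2 ⟨h1.2.2.2, h2.2.2.2⟩
  · exact le_antisymm h1.1 h2.1

lemma exists_eq_triangleGlue_of_le {V : Type*} {v : V} {G : SimpleGraph V} {p q r : Bool}
    {H : SimpleGraph (V ⊕ Fin 2)} (h : H ≤ triangleGlue v G p q r) :
    ∃ F p' q' r', H = triangleGlue v F p' q' r' := by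
  classical
  refine ⟨H.comap Sum.inl, decide (H.Adj (Sum.inl v) (Sum.inr 0)),
    decide (H.Adj (Sum.inl v) (Sum.inr 1)), decide (H.Adj (Sum.inr 0) (Sum.inr 1)), ?_⟩
  have h' : ∀ x c, H.Adj (Sum.inl x) (Sum.inr c) → x = v := fun x c hx => (h hx).1
  have := H.adj_comm
  ext (a | c) (b | d)
  · rfl
  · fin_cases d <;> simp [triangleGlue] <;> grind
  · fin_cases c <;> simp [triangleGlue] <;> grind
  · fin_cases c <;> fin_cases d <;> simp [triangleGlue]
    exact H.adj_comm ..

lemma card_subtype_eq_sum_triangleGlue {V : Type*} [Finite V] {v : V} {G : SimpleGraph V}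
    {p q r : Bool} {P : SimpleGraph (V ⊕ Fin 2) → Prop}
    (hP : ∀ H, P H → H ≤ triangleGlue v G p q r) :
    Nat.card {H // P H} = ∑ p', ∑ q', ∑ r', Nat.card {F // P (triangleGlue v F p' q' r')} := by
  have e : {t : Bool × Bool × Bool × SimpleGraph V //
      P (triangleGlue v t.2.2.2 t.1 t.2.1 t.2.2.1)} ≃ {H // P H} := by
    refine Equiv.ofBijective (fun t => ⟨_, t.2⟩) ⟨fun s t hst => ?_, fun ⟨H, hH⟩ => ?_⟩
    · exact Subtype.ext (triangleGlue_injective v (congrArg Subtype.val hst))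
    · obtain ⟨F, p', q', r', rfl⟩ := exists_eq_triangleGlue_of_le (hP H hH)
      exact ⟨⟨(p', q', r', F), hH⟩, rfl⟩
  have e' : {t : Bool × Bool × Bool × SimpleGraph V //
      P (triangleGlue v t.2.2.2 t.1 t.2.1 t.2.2.1)} ≃
      Σ p', Σ q', Σ r', {F // P (triangleGlue v F p' q' r')} :=
    { toFun := fun t => ⟨t.1.1, t.1.2.1, t.1.2.2.1, t.1.2.2.2, t.2⟩
      invFun := fun t => ⟨(t.1, t.2.1, t.2.2.1, t.2.2.2.1), t.2.2.2.2⟩ }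
  rw [← Nat.card_congr e, Nat.card_congr e']
  simp only [Nat.card_sigma]

lemma isSpanningTree_iff_forall_reachable {V : Type*} {G T : SimpleGraph V} (i : V) :
    IsSpanningTree G T ↔ T ≤ G ∧ T.IsAcyclic ∧ ∀ x, T.Reachable x i := by
  have : T.Connected ↔ ∀ x, T.Reachable x i :=
    ⟨fun h x => h.preconnected x i, fun h =>
      have : Nonempty V := ⟨i⟩
      ⟨fun x y => (h x).trans (h y).symm⟩⟩
  rw [IsSpanningTree, this]
  tauto

section TriangleGlueForests

variable {V : Type*} {v : V} {G F : SimpleGraph V} {p q r p' q' r' : Bool}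

lemma isSpanningTree_triangleGlue_iff :
    IsSpanningTree (triangleGlue v G p q r) (triangleGlue v F p' q' r') ↔
      IsSpanningTree G F ∧ (p' = true → p = true) ∧ (q' = true → q = true) ∧
        (r' = true → r = true) ∧ (bif p' then q' != r' else q' && r') = true := by
  rw [isSpanningTree_iff_forall_reachable v, isSpanningTree_iff_forall_reachable (Sum.inl v)]
  simp only [Sum.forall, Fin.forall_fin_two, reachable_triangleGlue_iff,
    isAcyclic_triangleGlue_iff, triangleGlue_le_iff, triangleGlueRel]
  cases p' <;> cases q' <;> cases r' <;> simp <;> tauto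

lemma isTwoForestSep_triangleGlue_inl_inl_iff {x y : V} :
    IsTwoForestSep (triangleGlue v G p q r) (triangleGlue v F p' q' r')
        (Sum.inl x) (Sum.inl y) ↔
      IsTwoForestSep G F x y ∧ (p' = true → p = true) ∧ (q' = true → q = true) ∧
        (r' = true → r = true) ∧ (bif p' then q' != r' else q' && r') = true := by
  simp only [IsTwoForestSep, Sum.forall, Fin.forall_fin_two, reachable_triangleGlue_iff,
    isAcyclic_triangleGlue_iff, triangleGlue_le_iff, triangleGlueRel]
  rw [F.reachable_comm (u := x) (v := v), F.reachable_comm (u := y) (v := v)]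
  cases p' <;> cases q' <;> cases r' <;> simp <;> grind

lemma isTwoForestSep_triangleGlue_inl_inr_zero_iff {x : V} :
    IsTwoForestSep (triangleGlue v G p q r) (triangleGlue v F p' q' r')
        (Sum.inl x) (Sum.inr 0) ↔
      ((p' = true → p = true) ∧ (q' = true → q = true) ∧ (r' = true → r = true)) ∧
      (IsTwoForestSep G F x v ∧ (bif p' then q' != r' else q' && r') = true ∨
        IsSpanningTree G F ∧ (!p' && (q' != r')) = true) := by
  rw [isSpanningTree_iff_forall_reachable x]
  simp only [IsTwoForestSep, Sum.forall, Fin.forall_fin_two, reachable_triangleGlue_iff,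
    isAcyclic_triangleGlue_iff, triangleGlue_le_iff, triangleGlueRel]
  have := F.reachable_comm (u := x) (v := v)
  cases p' <;> cases q' <;> cases r' <;> simp <;> grind

lemma isTwoForestSep_triangleGlue_inl_inr_one_iff {x : V} :
    IsTwoForestSep (triangleGlue v G p q r) (triangleGlue v F p' q' r')
        (Sum.inl x) (Sum.inr 1) ↔
      ((p' = true → p = true) ∧ (q' = true → q = true) ∧ (r' = true → r = true)) ∧
      (IsTwoForestSep G F x v ∧ (bif p' then q' != r' else q' && r') = true ∨
        IsSpanningTree G F ∧ (!q' && (p' != r')) = true) := by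
  rw [isSpanningTree_iff_forall_reachable x]
  simp only [IsTwoForestSep, Sum.forall, Fin.forall_fin_two, reachable_triangleGlue_iff,
    isAcyclic_triangleGlue_iff, triangleGlue_le_iff, triangleGlueRel]
  have := F.reachable_comm (u := x) (v := v)
  cases p' <;> cases q' <;> cases r' <;> simp <;> grind

lemma isTwoForestSep_triangleGlue_inr_inr_iff :
    IsTwoForestSep (triangleGlue v G p q r) (triangleGlue v F p' q' r')
        (Sum.inr 0) (Sum.inr 1) ↔
      IsSpanningTree G F ∧ (p' = true → p = true) ∧ (q' = true → q = true) ∧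
        (r' = true → r = true) ∧ (!r' && (p' != q')) = true := by
  rw [isSpanningTree_iff_forall_reachable v]
  simp only [IsTwoForestSep, Sum.forall, Fin.forall_fin_two, reachable_triangleGlue_iff,
    isAcyclic_triangleGlue_iff, triangleGlue_le_iff, triangleGlueRel]
  have : Nonempty V := ⟨v⟩
  cases p' <;> cases q' <;> cases r' <;> simp <;> grind

variable [Finite V]

lemma spanningTreeCount_triangleGlue (r : Bool) :
    spanningTreeCount (triangleGlue v G true true r) =
      (bif r then 3 else 1) * spanningTreeCount G := by
  rw [spanningTreeCount, card_subtype_eq_sum_triangleGlue fun H h => h.1, spanningTreeCount]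
  simp only [Fintype.sum_bool, isSpanningTree_triangleGlue_iff]
  cases r <;> simp; try ring

lemma twoForestCount_triangleGlue_inl_inl (r : Bool) (x y : V) :
    twoForestCount (triangleGlue v G true true r) (Sum.inl x) (Sum.inl y) =
      (bif r then 3 else 1) * twoForestCount G x y := by
  rw [twoForestCount, card_subtype_eq_sum_triangleGlue fun H h => h.1, twoForestCount]
  simp only [Fintype.sum_bool, isTwoForestSep_triangleGlue_inl_inl_iff]
  cases r <;> simp; try ring

lemma twoForestCount_triangleGlue_inl_inr (r : Bool) (x : V) (c : Fin 2) :
    twoForestCount (triangleGlue v G true true r) (Sum.inl x) (Sum.inr c) =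
      (bif r then 3 else 1) * twoForestCount G x v +
        (bif r then 2 else 1) * spanningTreeCount G := by
  rw [twoForestCount, card_subtype_eq_sum_triangleGlue fun H h => h.1, twoForestCount,
    spanningTreeCount]
  fin_cases c <;> simp only [Fintype.sum_bool, Fin.zero_eta, Fin.mk_one,
    isTwoForestSep_triangleGlue_inl_inr_zero_iff, isTwoForestSep_triangleGlue_inl_inr_one_iff] <;>
    cases r <;> simp <;> try ring

lemma twoForestCount_triangleGlue_inr_inr (r : Bool) :
    twoForestCount (triangleGlue v G true true r) (Sum.inr 0) (Sum.inr 1) =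
      2 * spanningTreeCount G := by
  rw [twoForestCount, card_subtype_eq_sum_triangleGlue fun H h => h.1, spanningTreeCount]
  simp only [Fintype.sum_bool, isTwoForestSep_triangleGlue_inr_inr_iff]
  cases r <;> simp <;> ring

end TriangleGlueForests

section TwoForestCount

variable {V : Type*} (G : SimpleGraph V)

lemma twoForestCount_self (x : V) : twoForestCount G x x = 0 := by
  simp [twoForestCount, IsTwoForestSep]

lemma twoForestCount_comm (x y : V) : twoForestCount G x y = twoForestCount G y x := by
  refine Nat.card_congr (Equiv.subtypeEquivRight fun F => ?_)
  rw [IsTwoForestSep, IsTwoForestSep, reachable_comm]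
  simp only [or_comm]

lemma twoForestCount_triangle [Finite V] (x v y : V) :
    twoForestCount G x y ≤ twoForestCount G x v + twoForestCount G v y := by
  change Set.ncard {F | IsTwoForestSep G F x y} ≤
    Set.ncard {F | IsTwoForestSep G F x v} + Set.ncard {F | IsTwoForestSep G F v y}
  refine (Set.ncard_le_ncard ?_ (Set.toFinite _)).trans (Set.ncard_union_le _ _)
  rintro F ⟨hle, hac, hsep, hcov⟩
  rcases hcov v with h | h
  · right
    refine ⟨hle, hac, fun hv => hsep (h.symm.trans hv), fun z => ?_⟩
    exact (hcov z).imp_left fun hz => hz.trans h.symm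
  · left
    refine ⟨hle, hac, fun hv => hsep (hv.trans h), fun z => ?_⟩
    exact (hcov z).imp_right fun hz => hz.trans h.symm

lemma exists_twoForestCount_pos [Finite V] [Nontrivial V] (hG : G.Connected) (v : V) :
    ∃ w, G.Adj w v ∧ 0 < twoForestCount G w v := by
  obtain ⟨T, hle, hT⟩ := hG.exists_isTree_le
  obtain ⟨w, hw⟩ := hT.1.preconnected.exists_adj_of_nontrivial v
  have hsep := isAcyclic_iff_forall_adj_not_reachable.1 hT.2 w v hw.symm
  refine ⟨w, hle hw.symm, ?_⟩
  have : Nonempty {F // IsTwoForestSep G F w v} := by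
    refine ⟨T.deleteEdges {s(w, v)}, (deleteEdges_le _).trans hle, hT.2.anti (deleteEdges_le _),
      hsep, fun z => ?_⟩
    have hz := (reachable_iff_reflTransGen _ _).1 (hT.1.preconnected v z)
    induction hz with
    | refl => exact .inr .rfl
    | @tail y z _ hyz ih =>
      by_cases h : s(y, z) = s(w, v)
      · rcases Sym2.eq_iff.1 h with ⟨-, rfl⟩ | ⟨-, rfl⟩
        exacts [.inr .rfl, .inl .rfl]
      · have hzy : (T.deleteEdges {s(w, v)}).Reachable z y :=
          (deleteEdges_adj.2 ⟨hyz, h⟩).reachable.symm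
        exact ih.imp hzy.trans hzy.trans
  exact Nat.card_pos

lemma spanningTreeCount_pos [Finite V] (hG : G.Connected) : 0 < spanningTreeCount G := by
  obtain ⟨T, hle, hT⟩ := hG.exists_isTree_le
  have : Nonempty {T // IsSpanningTree G T} := ⟨T, hle, hT.1, hT.2⟩
  exact Nat.card_pos

end TwoForestCount

section Degree

variable {V : Type*}

lemma sum_degVec [Fintype V] (G : SimpleGraph V) : ∑ x, degVec G x = 2 * edgeCount G := by
  classical
  have h := G.sum_degrees_eq_twice_card_edges
  simp only [degVec, edgeCount, Set.ncard_eq_toFinset_card', Set.toFinset_card,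
    card_neighborSet_eq_degree]
  rw [edgeFinset_card] at h
  exact_mod_cast h

lemma degVec_nonneg (G : SimpleGraph V) (x : V) : 0 ≤ degVec G x := Nat.cast_nonneg _

lemma one_le_degVec [Finite V] {G : SimpleGraph V} {x y : V} (h : G.Adj x y) :
    1 ≤ degVec G x := by
  have : 0 < (G.neighborSet x).ncard := (Set.ncard_pos).2 ⟨y, h⟩
  exact Nat.one_le_cast.2 this

lemma degVec_triangleGlue_inl [Finite V] [DecidableEq V] (v : V) (G : SimpleGraph V) (r : Bool)
    (x : V) : degVec (triangleGlue v G true true r) (Sum.inl x) =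
      degVec G x + if x = v then 2 else 0 := by
  have h : (triangleGlue v G true true r).neighborSet (Sum.inl x) =
      Sum.inl '' G.neighborSet x ∪ Sum.inr '' {_c : Fin 2 | x = v} := by
    ext (y | c) <;> simp [triangleGlue]
  have hd : Disjoint (Sum.inl '' G.neighborSet x) (Sum.inr '' {_c : Fin 2 | x = v}) := by
    simp [Set.disjoint_left]
  rw [degVec, h, Set.ncard_union_eq hd (Set.toFinite _) (Set.toFinite _),
    Set.ncard_image_of_injective _ Sum.inl_injective,
    Set.ncard_image_of_injective _ Sum.inr_injective, degVec]
  by_cases hx : x = v <;> simp [hx, Set.ncard_univ]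

lemma degVec_triangleGlue_inr (v : V) (G : SimpleGraph V) (r : Bool)
    (c : Fin 2) : degVec (triangleGlue v G true true r) (Sum.inr c) =
      bif r then 2 else 1 := by
  cases r
  · have h : (triangleGlue v G true true false).neighborSet (Sum.inr c) = {Sum.inl v} := by
      ext (y | d) <;> simp [triangleGlue]
    simp [degVec, h]
  · have h : (triangleGlue v G true true true).neighborSet (Sum.inr c) =
        {Sum.inl v, Sum.inr (1 - c)} := by
      ext (y | d) <;> simp [triangleGlue]
      omega
    simp [degVec, h]

lemma edgeCount_triangleGlue [Fintype V] (v : V) (G : SimpleGraph V) (r : Bool) :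
    edgeCount (triangleGlue v G true true r) = edgeCount G + bif r then 3 else 2 := by
  classical
  have h := sum_degVec (triangleGlue v G true true r)
  rw [Fintype.sum_sum_type] at h
  simp only [degVec_triangleGlue_inl, degVec_triangleGlue_inr, Finset.sum_add_distrib, sum_degVec,
    Fin.sum_univ_two, Finset.sum_ite_eq', Finset.mem_univ, if_true] at h
  cases r <;> simp at h ⊢ <;> linarith

/-- The quadratic form of the 2-forest matrix of a graph with a triangle or two pendant vertices
attached at `v`, in terms of the original graph. -/
lemma dotProduct_forestMatrix_triangleGlue [Fintype V] (v : V) (G : SimpleGraph V) (r : Bool) :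
    degVec (triangleGlue v G true true r) ⬝ᵥ
        (forestMatrix (triangleGlue v G true true r)).mulVec
          (degVec (triangleGlue v G true true r)) =
      (bif r then 3 else 1) * (degVec G ⬝ᵥ (forestMatrix G).mulVec (degVec G)) +
      (bif r then 36 else 8) * ∑ x, degVec G x * twoForestCount G x v +
      (bif r then 32 * edgeCount G + 48 else 8 * edgeCount G + 12) * spanningTreeCount G := by
  classical
  have hself := twoForestCount_self (triangleGlue v G true true r)
  have hcomm : ∀ (x : V) (c : Fin 2),
      twoForestCount (triangleGlue v G true true r) (Sum.inr c) (Sum.inl x) =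
        twoForestCount (triangleGlue v G true true r) (Sum.inl x) (Sum.inr c) :=
    fun _ _ => twoForestCount_comm ..
  have hcomm' := twoForestCount_comm (triangleGlue v G true true r) (Sum.inr 1) (Sum.inr 0)
  have hvv : ∀ x, twoForestCount G v x = twoForestCount G x v := fun x => twoForestCount_comm ..
  have hd := sum_degVec G
  simp only [dotProduct, mulVec, forestMatrix, Matrix.of_apply, Fintype.sum_sum_type,
    Fin.sum_univ_two, hself, hcomm, hcomm', twoForestCount_triangleGlue_inl_inl,
    twoForestCount_triangleGlue_inl_inr, twoForestCount_triangleGlue_inr_inr,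
    degVec_triangleGlue_inl, degVec_triangleGlue_inr]
  push_cast
  have hadd (f : V → ℝ) : ∑ x, (degVec G x + if x = v then 2 else 0) * f x =
      ∑ x, degVec G x * f x + 2 * f v := by
    simp [add_mul, Finset.sum_add_distrib]
  have hadd' (f : V → ℝ) : ∑ x, f x * (degVec G x + if x = v then 2 else 0) =
      ∑ x, degVec G x * f x + 2 * f v := by
    simp only [mul_comm (f _), hadd]
  simp only [hadd, hadd', hvv, twoForestCount_self]
  have hS (x y) : (twoForestCount G x y : ℝ) * degVec G y = degVec G y * twoForestCount G x y :=
    mul_comm _ _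
  have hconst (c : ℝ) (f : V → ℝ) : ∑ x, degVec G x * (c * f x) = c * ∑ x, degVec G x * f x := by
    simp only [Finset.mul_sum, mul_left_comm]
  have hconst' (c : ℝ) (f : V → ℝ) : ∑ x, degVec G x * (f x * c) = c * ∑ x, degVec G x * f x := by
    simp only [mul_comm _ c, hconst]
  cases r <;>
    simp only [cond_true, cond_false, Nat.cast_one, Nat.cast_ofNat, one_mul, mul_one, mul_add,
      add_mul, Finset.sum_add_distrib, hconst, hconst', ← Finset.sum_mul, hd, hS] <;>
    push_cast <;> ring

end Degree

lemma dotProduct_forestMatrix_lt {V : Type*} [Fintype V] [Nontrivial V] (G : SimpleGraph V)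
    (hG : G.Connected) (v : V) :
    degVec G ⬝ᵥ (forestMatrix G).mulVec (degVec G) <
      4 * edgeCount G * ∑ x, degVec G x * twoForestCount G x v := by
  have hd := sum_degVec G
  obtain ⟨w, hw, hwv⟩ := exists_twoForestCount_pos G hG v
  have hsum : 4 * edgeCount G * ∑ x, degVec G x * twoForestCount G x v =
      ∑ x, degVec G x * ∑ y, (twoForestCount G x v + twoForestCount G v y) * degVec G y := by
    have h (y) : (twoForestCount G v y : ℝ) * degVec G y = degVec G y * twoForestCount G y v := by
      rw [twoForestCount_comm, mul_comm]
    simp only [add_mul, Finset.sum_add_distrib, ← Finset.mul_sum, hd, mul_add, ← Finset.sum_mul, h,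
      ← mul_assoc]
    ring
  have hle (x y : V) : (twoForestCount G x y : ℝ) * degVec G y ≤
      (twoForestCount G x v + twoForestCount G v y) * degVec G y :=
    mul_le_mul_of_nonneg_right (mod_cast twoForestCount_triangle G x v y) (degVec_nonneg G y)
  have hdw : 0 < degVec G w := zero_lt_one.trans_le (one_le_degVec hw)
  rw [hsum]
  refine Finset.sum_lt_sum
    (fun x _ => mul_le_mul_of_nonneg_left (Finset.sum_le_sum fun y _ => hle x y)
      (degVec_nonneg G x))
    ⟨w, Finset.mem_univ _, mul_lt_mul_of_pos_left
      (Finset.sum_lt_sum (fun y _ => hle w y) ⟨w, Finset.mem_univ _, ?_⟩) hdw⟩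
  refine mul_lt_mul_of_pos_right ?_ hdw
  change (twoForestCount G w w : ℝ) < _
  rw [twoForestCount_self, Nat.cast_zero]
  have : (0 : ℝ) < twoForestCount G w v := mod_cast hwv
  positivity

lemma one_le_edgeCount {V : Type*} [Finite V] [Nontrivial V] (G : SimpleGraph V)
    (hG : G.Connected) : 1 ≤ edgeCount G := by
  obtain ⟨v, w, hvw⟩ := exists_pair_ne V
  obtain ⟨w, hw⟩ := hG.preconnected.exists_adj_of_nontrivial v
  have : 0 < G.edgeSet.ncard := (Set.ncard_pos).2 ⟨s(v, w), hw⟩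
  exact Nat.one_le_cast.2 this

/-- Every nontrivial connected graph is twin-Braess. -/
theorem twin_braess {V : Type*} [Fintype V] [DecidableEq V] [Nontrivial V]
    (G : SimpleGraph V) (hG : G.Connected) (v : V) :
    kemeny (hatG G v) > kemeny (tildeG G v) := by
  have hK := dotProduct_forestMatrix_lt G hG v
  have hm := one_le_edgeCount G hG
  have ht : (0 : ℝ) < spanningTreeCount G := mod_cast spanningTreeCount_pos G hG
  rw [hatG_eq_triangleGlue, tildeG_eq_triangleGlue]
  simp only [kemeny, dotProduct_forestMatrix_triangleGlue, edgeCount_triangleGlue,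
    spanningTreeCount_triangleGlue, cond_true, cond_false]
  push_cast
  set K := degVec G ⬝ᵥ (forestMatrix G).mulVec (degVec G)
  set ρ := ∑ x, degVec G x * (twoForestCount G x v : ℝ)
  set m := edgeCount G
  set t : ℝ := (spanningTreeCount G : ℝ)
  rw [gt_iff_lt, div_lt_div_iff₀ (by positivity) (by positivity), ← sub_pos]
  have key : 0 < 12 * t * (4 * m * ρ - K) + 16 * t ^ 2 * (m - 1) * (2 * m + 3) := by
    have h1 : 0 < 12 * t * (4 * m * ρ - K) := mul_pos (by positivity) (sub_pos.2 hK)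
    have h2 : 0 ≤ 16 * t ^ 2 * (m - 1) * (2 * m + 3) :=
      mul_nonneg (mul_nonneg (by positivity) (sub_nonneg.2 hm)) (by linarith)
    linarith
  linarith
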